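/- Let G be a simple graph on a finite vertex set V with a symmetric nonnegative edge-weight function w and weighted shortest-path distance d, let V be partitioned into pairwise disjoint sets A, S, B such that no edge of G joins a vertex of A to a vertex of B, and let P ⊆ V be a set of sites. Then for every q ∈ A, ⨅_{p ∈ P} d(q,p) = min( ⨅_{p ∈ P ∩ A} d_A(q,p) , ⨅_{s ∈ S} ( d(q,s) + ⨅_{p ∈ P} d(s,p) ) ), where d_A denotes the weighted shortest-path distance in the subgraph of G induced on A. (That is, the distance from q to the nearest site is achieved either by a path staying entirely within q's side of the separation, or by a path passing through some separator vertex s and then continuing to the site nearest to s.) -/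

import Mathlib

open scoped ENNReal

/-- The total weight of a walk: the sum, over the edges (darts) of the walk,
of their weights. -/
noncomputable def walkWeight {V : Type*} {G : SimpleGraph V} (w : V → V → ℝ≥0∞)
    {u v : V} (p : G.Walk u v) : ℝ≥0∞ :=
  (p.darts.map (fun d => w d.toProd.1 d.toProd.2)).sum

/-- The weighted shortest-path distance: the infimum in `ℝ≥0∞` over all walks
from `u` to `v` of their total weight (`∞` if no walk exists). -/
noncomputable def gdist {V : Type*} (G : SimpleGraph V) (w : V → V → ℝ≥0∞)
    (u v : V) : ℝ≥0∞ :=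
  ⨅ p : G.Walk u v, walkWeight w p

section WalkWeight

variable {V : Type*} {G : SimpleGraph V} (w : V → V → ℝ≥0∞)

@[simp]
theorem walkWeight_nil (u : V) : walkWeight w (.nil : G.Walk u u) = 0 := by
  simp [walkWeight]

@[simp]
theorem walkWeight_cons {u v x : V} (h : G.Adj u v) (p : G.Walk v x) :
    walkWeight w (.cons h p) = w u v + walkWeight w p := by
  simp [walkWeight]

theorem walkWeight_append {u v x : V} (p : G.Walk u v) (p' : G.Walk v x) :
    walkWeight w (p.append p') = walkWeight w p + walkWeight w p' := by
  simp [walkWeight]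

theorem walkWeight_map {V' : Type*} {G' : SimpleGraph V'} (f : G' →g G) {u v : V'}
    (p : G'.Walk u v) :
    walkWeight w (p.map f) = walkWeight (fun a b => w (f a) (f b)) p := by
  induction p with
  | nil => simp
  | cons h p ih => simp [ih]

theorem gdist_le_walkWeight {u v : V} (p : G.Walk u v) : gdist G w u v ≤ walkWeight w p :=
  iInf_le _ p

theorem gdist_self (u : V) : gdist G w u u = 0 :=
  le_antisymm ((gdist_le_walkWeight w .nil).trans_eq (walkWeight_nil w u)) zero_le

theorem gdist_le_of_adj {u v : V} (h : G.Adj u v) : gdist G w u v ≤ w u v :=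
  (gdist_le_walkWeight w (.cons h .nil)).trans_eq (by simp)

theorem gdist_triangle (u v x : V) : gdist G w u x ≤ gdist G w u v + gdist G w v x := by
  conv_rhs => rw [gdist, gdist, ENNReal.iInf_add]
  refine le_iInf fun p => ?_
  rw [ENNReal.add_iInf]
  exact le_iInf fun p' =>
    (gdist_le_walkWeight w (p.append p')).trans_eq (walkWeight_append w p p')

theorem gdist_map_le {V' : Type*} {G' : SimpleGraph V'} (f : G' →g G) (u v : V') :
    gdist G w (f u) (f v) ≤ gdist G' (fun a b => w (f a) (f b)) u v :=
  le_iInf fun p => (gdist_le_walkWeight w (p.map f)).trans_eq (walkWeight_map w f p)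

/-- If every neighbour of `A` outside `A` lies in `S`, then a walk starting in `A` either is at
least as long as the distance within `A`, or is at least as long as some detour through `S`. -/
theorem gdist_induce_le_or_exists_gdist_add_le {A S : Set V}
    (hnbr : ∀ a ∈ A, ∀ b, G.Adj a b → b ∈ A ∨ b ∈ S) {u v : V} (p : G.Walk u v) (hu : u ∈ A) :
    (∃ hv : v ∈ A,
      gdist (G.induce A) (fun a b => w a.val b.val) ⟨u, hu⟩ ⟨v, hv⟩ ≤ walkWeight w p) ∨
    ∃ s ∈ S, gdist G w u s + gdist G w s v ≤ walkWeight w p := by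
  induction p with
  | nil => exact .inl ⟨hu, (gdist_self _ _).trans_le zero_le⟩
  | @cons u y v h p ih =>
    rw [walkWeight_cons]
    rcases hnbr u hu y h with hy | hy
    · rcases ih hy with ⟨hv, hle⟩ | ⟨s, hs, hle⟩
      · refine .inl ⟨hv, (gdist_triangle _ _ ⟨y, hy⟩ _).trans (add_le_add ?_ hle)⟩
        exact gdist_le_of_adj (G := G.induce A) (fun a b => w a.val b.val) (by simpa using h)
      · refine .inr ⟨s, hs, ?_⟩
        calc gdist G w u s + gdist G w s v
            ≤ (w u y + gdist G w y s) + gdist G w s v := by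
              gcongr
              exact (gdist_triangle w u y s).trans (by gcongr; exact gdist_le_of_adj w h)
          _ ≤ w u y + walkWeight w p := by
              rw [add_assoc]
              gcongr
    · exact .inr ⟨y, hy, add_le_add (gdist_le_of_adj w h) (gdist_le_walkWeight w p)⟩

end WalkWeight

/-- Let `A, S, B` be a separation of a finite weighted simple
graph `G` and let `P` be a set of sites. Then for every `q ∈ A`, the distance from
`q` to the nearest site equals the minimum of (a) the distance, within the subgraph
induced on `A`, from `q` to the nearest site in `P ∩ A`, and (b) the minimum over
separator vertices `s` of `d(q,s)` plus the distance from `s` to its nearest site. -/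
theorem nearest_site_via_separator {V : Type*} [Fintype V]
    (G : SimpleGraph V) (w : V → V → ℝ≥0∞)
    (hsymm : ∀ u v, w u v = w v u)
    (A S B : Set V)
    (hAS : Disjoint A S) (hAB : Disjoint A B) (hSB : Disjoint S B)
    (hcover : A ∪ S ∪ B = Set.univ)
    (hsep : ∀ a ∈ A, ∀ b ∈ B, ¬ G.Adj a b)
    (P : Set V)
    (q : V) (hq : q ∈ A) :
    (⨅ p ∈ P, gdist G w q p)
      = min
          (⨅ (p : V) (hp : p ∈ P ∩ A),
            gdist (G.induce A) (fun a b => w a.val b.val) ⟨q, hq⟩ ⟨p, hp.2⟩)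
          (⨅ s ∈ S, (gdist G w q s + ⨅ p ∈ P, gdist G w s p)) := by
  have hnbr : ∀ a ∈ A, ∀ b, G.Adj a b → b ∈ A ∨ b ∈ S := by
    intro a ha b hab
    have hb : b ∈ A ∪ S ∪ B := hcover ▸ Set.mem_univ b
    exact hb.resolve_right fun hbB => hsep a ha b hbB hab
  refine le_antisymm (le_min ?_ ?_) ?_
  · exact le_iInf₂ fun p hp => (iInf₂_le p hp.1).trans
      (gdist_map_le w (SimpleGraph.Embedding.induce A).toHom ⟨q, hq⟩ ⟨p, hp.2⟩)
  · refine le_iInf₂ fun s _ => ?_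
    simp only [ENNReal.add_iInf]
    exact le_iInf₂ fun p hp => (iInf₂_le p hp).trans (gdist_triangle w q s p)
  · refine le_iInf₂ fun p hp => le_iInf fun walk => ?_
    rcases gdist_induce_le_or_exists_gdist_add_le w hnbr walk hq with ⟨hpA, hle⟩ | ⟨s, hs, hle⟩
    · exact (min_le_left _ _).trans ((iInf₂_le p ⟨hp, hpA⟩).trans hle)
    · refine (min_le_right _ _).trans ((iInf₂_le s hs).trans (le_trans ?_ hle))
      gcongr
      exact iInf₂_le p hp
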